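/- arXiv:2405.02081 — 2 statements merged into one kernel-verified Lean document; each statement's English description precedes it below -/
import Mathlib

section
/- Federated SimCLR lower bound (Equation 5, discrete version): Let S be a random variable on a finite type with pmf p(s), and for each s let p(z1, z2 | s) be a joint pmf of (Z1, Z2) on a finite type Z × Z. Let f : Z × Z → ℝ be a critic function, K ≥ 1 a natural number, and r(s | z) a conditional probability mass function over the values of S with r(s | z) > 0 whenever the corresponding marginal joint probability P(S=s, Z1=z) > 0 or P(S=s, Z2=z) > 0. Then I(Z1; Z2) ≥ ∑_s p(s) · E[ (1/K) ∑_{k=1}^{K} ( log( exp(f(z1_k, z2_k)) / ( (1/K) ∑_{j=1}^{K} exp(f(z1_j, z2_k)) ) ) + log r(s | z1_k) + log r(s | z2_k) ) ] + H(S), where the expectation is over K pairs (z1_k, z2_k) drawn i.i.d. from p(z1, z2 | s). -/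
/-!
Federated SimCLR lower bound (Equation 5, discrete version):
With `S ~ pS` and `(Z1, Z2) | S = s ~ pC s` (joint pmf `p s z1 z2 = pS s * pC s z1 z2`),
for any critic `f`, any `K ≥ 1` and any client classifier `r (s | z)` positive
on the support of the joint marginals with either view,
I(Z1; Z2) ≥ ∑_s p(s) · E[ (1/K) ∑_k ( InfoNCE term + log r(s|z1_k) + log r(s|z2_k) ) ] + H(S).
-/

open Finset

noncomputable section

variable {S Z : Type*} [Fintype S] [Fintype Z]

/-- Marginal P(Z1 = z1, Z2 = z2) of the joint pmf. -/
def margZ1Z2 (p : S → Z → Z → ℝ) (z1 z2 : Z) : ℝ := ∑ s, p s z1 z2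

/-- Marginal P(Z1 = z1). -/
def margZ1 (p : S → Z → Z → ℝ) (z1 : Z) : ℝ := ∑ s, ∑ z2, p s z1 z2

/-- Marginal P(Z2 = z2). -/
def margZ2 (p : S → Z → Z → ℝ) (z2 : Z) : ℝ := ∑ s, ∑ z1, p s z1 z2

/-- Marginal P(S = s, Z1 = z1). -/
def margSZ1 (p : S → Z → Z → ℝ) (s : S) (z1 : Z) : ℝ := ∑ z2, p s z1 z2

/-- Marginal P(S = s, Z2 = z2). -/
def margSZ2 (p : S → Z → Z → ℝ) (s : S) (z2 : Z) : ℝ := ∑ z1, p s z1 z2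

/-- Mutual information I(Z1; Z2), with terms of zero joint probability
contributing 0. -/
def miZ1Z2 (p : S → Z → Z → ℝ) : ℝ :=
  ∑ z1, ∑ z2, margZ1Z2 p z1 z2 *
    Real.log (margZ1Z2 p z1 z2 / (margZ1 p z1 * margZ2 p z2))

/-- The Gibbs inequality for nonnegative weights that need not be normalized. -/
theorem sum_mul_log_div_le {ι : Type*} [Fintype ι] (w t : ι → ℝ) (hw : ∀ i, 0 ≤ w i)
    (ht : ∀ i, 0 ≤ t i) (hwt : ∀ i, 0 < w i → 0 < t i) :
    ∑ i, w i * Real.log (t i / w i) ≤ ∑ i, t i - ∑ i, w i := by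
  rw [← Finset.sum_sub_distrib]
  refine Finset.sum_le_sum fun i _ => ?_
  rcases (hw i).eq_or_lt with h | h
  · simpa [← h] using ht i
  · have hlog := Real.log_le_sub_one_of_pos (div_pos (hwt i h) h)
    calc w i * Real.log (t i / w i) ≤ w i * (t i / w i - 1) :=
          mul_le_mul_of_nonneg_left hlog h.le
      _ = t i - w i := by field_simp

theorem sum_pi_prod {ι α : Type*} [Fintype ι] [DecidableEq ι] [Fintype α] (F : ι → α → ℝ) :
    ∑ v : ι → α, ∏ j, F j (v j) = ∏ j, ∑ a, F j a := by
  rw [Finset.prod_univ_sum, Fintype.piFinset_univ]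

/-- The expectation of a function of one coordinate under a product distribution. -/
theorem sum_pi_prod_mul_eval {ι α : Type*} [Fintype ι] [DecidableEq ι] [Fintype α] (q : α → ℝ)
    (hq : ∑ a, q a = 1) (h : α → ℝ) (k : ι) :
    ∑ v : ι → α, (∏ j, q (v j)) * h (v k) = ∑ a, q a * h a := by
  have hv (v : ι → α) : (∏ j, q (v j)) * h (v k) =
      ∏ j, q (v j) * (if j = k then h (v j) else 1) := by
    rw [Finset.prod_mul_distrib, Finset.prod_ite_eq' Finset.univ k]
    simp
  simp_rw [hv]
  rw [sum_pi_prod (fun j a => q a * (if j = k then h a else 1)),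
    Finset.prod_eq_single_of_mem k (Finset.mem_univ k) (fun j _ hj => by simp [hj, hq])]
  simp

/-- Replacing the joint pmf of the `k`-th pair by the product of its marginals makes the second
component of that pair independent of all the first components. -/
theorem sum_pi_prod_update_marginals {ι α β : Type*} [Fintype ι] [DecidableEq ι] [Fintype α]
    [Fintype β] (q : α → β → ℝ) (c : β → ℝ) (k : ι) (G : (ι → α) → β → ℝ) :
    ∑ v : ι → α × β, (∏ j, if j = k then (∑ b, q (v j).1 b) * c (v j).2
        else q (v j).1 (v j).2) * G (fun j => (v j).1) (v k).2 =
      ∑ b, c b * ∑ x : ι → α, (∏ j, ∑ b, q (x j) b) * G x b := by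
  rw [← (Equiv.arrowProdEquivProdArrow ι (fun _ => α) (fun _ => β)).symm.sum_comp,
    Fintype.sum_prod_type]
  simp_rw [Finset.mul_sum]
  refine Eq.trans ?_ Finset.sum_comm
  refine Finset.sum_congr rfl fun x _ => ?_
  have hy (y : ι → β) :
      (∏ j, if j = k then (∑ b, q (x j) b) * c (y j) else q (x j) (y j)) * G x (y k) =
      ∏ j, if j = k then (∑ b, q (x j) b) * (c (y j) * G x (y j)) else q (x j) (y j) := by
    rw [← Finset.mul_prod_erase _ _ (Finset.mem_univ k),
      ← Finset.mul_prod_erase Finset.univ _ (Finset.mem_univ k)]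
    have hne : ∀ j ∈ Finset.univ.erase k, j ≠ k := fun j hj => Finset.ne_of_mem_erase hj
    rw [Finset.prod_congr rfl fun j hj => if_neg (hne j hj),
      Finset.prod_congr (g := fun j => q (x j) (y j)) rfl fun j hj => if_neg (hne j hj)]
    simp only [if_true]
    ring
  refine (Finset.sum_congr rfl fun y _ => hy y).trans ?_
  rw [sum_pi_prod (fun j b' => if j = k then (∑ b, q (x j) b) * (c b' * G x b')
    else q (x j) b')]
  rw [← Finset.mul_prod_erase _ _ (Finset.mem_univ k),
    Finset.prod_congr (g := fun j => ∑ b, q (x j) b) rfl fun j hj => by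
      simp only [if_neg (Finset.ne_of_mem_erase hj)]]
  simp only [if_true]
  rw [← Finset.mul_sum, mul_right_comm,
    Finset.mul_prod_erase Finset.univ (fun j => ∑ b, q (x j) b) (Finset.mem_univ k),
    Finset.mul_sum]
  exact Finset.sum_congr rfl fun b _ => by ring

/-- The InfoNCE lower bound on the mutual information of the pmf `q`. -/
theorem infoNCE_le_mutualInfo {α β : Type*} [Fintype α] [Fintype β] (q : α → β → ℝ)
    (hq_nonneg : ∀ a b, 0 ≤ q a b) (hq_sum : ∑ a, ∑ b, q a b = 1) (K : ℕ) (hK : 1 ≤ K)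
    (f : α → β → ℝ) :
    ∑ v : Fin K → α × β, (∏ k, q (v k).1 (v k).2) * ((1 / (K : ℝ)) * ∑ k : Fin K,
        Real.log (Real.exp (f (v k).1 (v k).2) /
          ((1 / (K : ℝ)) * ∑ j : Fin K, Real.exp (f (v j).1 (v k).2)))) ≤
      ∑ a, ∑ b, q a b * Real.log (q a b / ((∑ b', q a b') * ∑ a', q a' b)) := by
  have hK0 : (0 : ℝ) < K := by exact_mod_cast hK
  have : Nonempty (Fin K) := ⟨⟨0, hK⟩⟩
  set M : ℝ := ∑ a, ∑ b, q a b * Real.log (q a b / ((∑ b', q a b') * ∑ a', q a' b))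
  let G (k : Fin K) (x : Fin K → α) (b : β) : ℝ :=
    Real.exp (f (x k) b) / ((1 / (K : ℝ)) * ∑ j : Fin K, Real.exp (f (x j) b))
  have hmean (x : Fin K → α) (b : β) : 0 < (1 / (K : ℝ)) * ∑ j : Fin K, Real.exp (f (x j) b) :=
    mul_pos (by positivity)
      (Finset.sum_pos (fun j _ => Real.exp_pos _) Finset.univ_nonempty)
  have hG (k x b) : 0 < G k x b := div_pos (Real.exp_pos _) (hmean x b)
  have hG_sum (x : Fin K → α) (b : β) : ∑ k, G k x b = K := by
    have h := (hmean x b).ne'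
    rw [← Finset.sum_div, div_eq_iff h]
    field_simp
  have hm1 (a : α) (b : β) (h : 0 < q a b) : 0 < ∑ b', q a b' :=
    Finset.sum_pos' (fun b' _ => hq_nonneg a b') ⟨b, Finset.mem_univ b, h⟩
  have hm2 (a : α) (b : β) (h : 0 < q a b) : 0 < ∑ a', q a' b :=
    Finset.sum_pos' (fun a' _ => hq_nonneg a' b) ⟨a, Finset.mem_univ a, h⟩
  have hq_sum' : ∑ c : α × β, q c.1 c.2 = 1 := by rw [Fintype.sum_prod_type]; exact hq_sum
  have hone : ∑ v : Fin K → α × β, ∏ j, q (v j).1 (v j).2 = 1 := by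
    rw [sum_pi_prod (fun _ (c : α × β) => q c.1 c.2)]
    simp [hq_sum']
  have hcoord (k : Fin K) :
      ∑ v : Fin K → α × β, (∏ j, q (v j).1 (v j).2) *
        Real.log (G k (fun j => (v j).1) (v k).2) ≤
      M + (∑ b, (∑ a, q a b) * ∑ x : Fin K → α, (∏ j, ∑ b, q (x j) b) * G k x b - 1) := by
    let t (v : Fin K → α × β) : ℝ := (∏ j, if j = k then (∑ b, q (v j).1 b) * ∑ a, q a (v j).2
        else q (v j).1 (v j).2) * G k (fun j => (v j).1) (v k).2
    have hpos (v : Fin K → α × β) (h : 0 < ∏ j, q (v j).1 (v j).2) (j : Fin K) :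
        0 < q (v j).1 (v j).2 :=
      (hq_nonneg _ _).lt_of_ne' (Finset.prod_ne_zero_iff.1 h.ne' j (Finset.mem_univ j))
    have hgibbs := sum_mul_log_div_le (fun v : Fin K → α × β => ∏ j, q (v j).1 (v j).2) t
      (fun v => Finset.prod_nonneg fun j _ => hq_nonneg _ _)
      (fun v => mul_nonneg (Finset.prod_nonneg fun j _ => by
        split_ifs
        · exact mul_nonneg (Finset.sum_nonneg fun b _ => hq_nonneg _ _)
            (Finset.sum_nonneg fun a _ => hq_nonneg _ _)
        · exact hq_nonneg _ _) (hG k (fun j => (v j).1) (v k).2).le)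
      (fun v h => mul_pos (Finset.prod_pos fun j _ => by
        split_ifs
        · exact mul_pos (hm1 _ _ (hpos v h j)) (hm2 _ _ (hpos v h j))
        · exact hpos v h j) (hG k (fun j => (v j).1) (v k).2))
    rw [sum_pi_prod_update_marginals q (fun b => ∑ a, q a b) k (G k), hone] at hgibbs
    have hM' : ∑ v : Fin K → α × β, (∏ j, q (v j).1 (v j).2) *
        Real.log (q (v k).1 (v k).2 / ((∑ b', q (v k).1 b') * ∑ a', q a' (v k).2)) = M := by
      rw [sum_pi_prod_mul_eval (fun c : α × β => q c.1 c.2) hq_sum'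
        (fun c => Real.log (q c.1 c.2 / ((∑ b', q c.1 b') * ∑ a', q a' c.2))) k,
        Fintype.sum_prod_type]
    rw [← hM']
    refine le_trans (le_of_eq ?_) (add_le_add_right hgibbs _)
    rw [← Finset.sum_add_distrib]
    refine Finset.sum_congr rfl fun v _ => ?_
    have hnonneg : 0 ≤ ∏ j, q (v j).1 (v j).2 := Finset.prod_nonneg fun j _ => hq_nonneg _ _
    rcases hnonneg.eq_or_lt with h | h
    · simp only [← h, zero_mul, add_zero]
    · have hqk := hpos v h k
      have h1 := hm1 _ _ hqk
      have h2 := hm2 _ _ hqk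
      have ht : t v / ∏ j, q (v j).1 (v j).2 =
          ((∑ b', q (v k).1 b') * ∑ a', q a' (v k).2) / q (v k).1 (v k).2 *
            G k (fun j => (v j).1) (v k).2 := by
        have hrest : (∏ j, if j = k then (∑ b, q (v j).1 b) * ∑ a, q a (v j).2
            else q (v j).1 (v j).2) * q (v k).1 (v k).2 =
            ((∑ b', q (v k).1 b') * ∑ a', q a' (v k).2) * ∏ j, q (v j).1 (v j).2 := by
          rw [← Finset.mul_prod_erase _ _ (Finset.mem_univ k),
            ← Finset.mul_prod_erase Finset.univ (fun j => q (v j).1 (v j).2) (Finset.mem_univ k),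
            Finset.prod_congr (g := fun j => q (v j).1 (v j).2) rfl fun j hj =>
              if_neg (Finset.ne_of_mem_erase hj)]
          simp only [if_true]
          ring
        rw [div_mul_eq_mul_div, div_eq_div_iff h.ne' hqk.ne', mul_right_comm, hrest]
        ring
      rw [ht, Real.log_mul (by positivity) (hG k (fun j => (v j).1) (v k).2).ne', ← mul_add,
        Real.log_div hqk.ne' (by positivity), Real.log_div (by positivity) hqk.ne']
      ring
  have hsum := Finset.sum_le_sum fun k (_ : k ∈ Finset.univ) => hcoord k
  have hm1_sum : ∑ x : Fin K → α, ∏ j, ∑ b, q (x j) b = 1 := by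
    rw [sum_pi_prod (fun _ a => ∑ b, q a b)]
    simp [hq_sum]
  have hneg : ∑ k, ∑ b, (∑ a, q a b) * ∑ x : Fin K → α, (∏ j, ∑ b, q (x j) b) * G k x b =
      K := by
    rw [Finset.sum_comm]
    simp_rw [← Finset.mul_sum]
    have hinner (b : β) :
        ∑ k, ∑ x : Fin K → α, (∏ j, ∑ b, q (x j) b) * G k x b = K := by
      rw [Finset.sum_comm]
      simp_rw [← Finset.mul_sum, hG_sum]
      rw [← Finset.sum_mul, hm1_sum, one_mul]
    simp_rw [hinner]
    rw [← Finset.sum_mul, Finset.sum_comm, hq_sum, one_mul]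
  rw [Finset.sum_add_distrib, Finset.sum_sub_distrib, hneg] at hsum
  simp only [Finset.sum_const, Finset.card_univ, Fintype.card_fin, nsmul_eq_mul, mul_one,
    sub_self, add_zero] at hsum
  have hrw : ∑ v : Fin K → α × β, (∏ k, q (v k).1 (v k).2) * ((1 / (K : ℝ)) * ∑ k : Fin K,
        Real.log (G k (fun j => (v j).1) (v k).2)) =
      (1 / (K : ℝ)) * ∑ k, ∑ v : Fin K → α × β, (∏ j, q (v j).1 (v j).2) *
        Real.log (G k (fun j => (v j).1) (v k).2) := by
    rw [Finset.sum_comm, Finset.mul_sum]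
    refine Finset.sum_congr rfl fun v _ => ?_
    rw [← Finset.mul_sum]
    ring
  refine hrw.trans_le ?_
  rw [one_div, inv_mul_le_iff₀ hK0]
  exact hsum

/-- The variational lower bound `I(S; Z1) ≥ E[log r(S | Z1)] + H(S)`, stated as the nonnegativity
of the divergence of `r` from the posterior of `S`. -/
theorem sum_mul_log_classifier_div_posterior_nonpos (p : S → Z → Z → ℝ)
    (hp : ∀ s z1 z2, 0 ≤ p s z1 z2) (r : Z → S → ℝ) (hr_nonneg : ∀ z s, 0 ≤ r z s)
    (hr_sum : ∀ z, ∑ s, r z s = 1) (hr_pos : ∀ s z, 0 < margSZ1 p s z → 0 < r z s) :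
    ∑ s, ∑ z1, ∑ z2, p s z1 z2 * Real.log (r z1 s * margZ1 p z1 / margSZ1 p s z1) ≤ 0 := by
  have hmarg (s z) : 0 ≤ margSZ1 p s z := Finset.sum_nonneg fun _ _ => hp _ _ _
  have hmarg1 (z) : 0 ≤ margZ1 p z := Finset.sum_nonneg fun s _ => hmarg s z
  have hgibbs := sum_mul_log_div_le (fun c : S × Z => margSZ1 p c.1 c.2)
    (fun c => r c.2 c.1 * margZ1 p c.2) (fun c => hmarg _ _)
    (fun c => mul_nonneg (hr_nonneg _ _) (hmarg1 _))
    (fun c h => mul_pos (hr_pos _ _ h)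
      (Finset.sum_pos' (fun s _ => hmarg s c.2) ⟨c.1, Finset.mem_univ _, h⟩))
  simp only [Fintype.sum_prod_type] at hgibbs
  have hmass : ∑ s, ∑ z, r z s * margZ1 p z = ∑ s, ∑ z, margSZ1 p s z := by
    rw [Finset.sum_comm, Finset.sum_comm (f := fun s z => margSZ1 p s z)]
    refine Finset.sum_congr rfl fun z _ => ?_
    rw [← Finset.sum_mul, hr_sum, one_mul]
    rfl
  rw [hmass, sub_self] at hgibbs
  simpa only [margSZ1, Finset.sum_mul] using hgibbs

/-- Federated SimCLR lower bound on the global multi-view mutual information. -/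
theorem federated_simclr_lower_bound
    (pS : S → ℝ) (pC : S → Z → Z → ℝ)
    (hpS_nonneg : ∀ s, 0 ≤ pS s) (hpS_sum : ∑ s, pS s = 1)
    (hpC_nonneg : ∀ s z1 z2, 0 ≤ pC s z1 z2)
    (hpC_sum : ∀ s, ∑ z1, ∑ z2, pC s z1 z2 = 1)
    (K : ℕ) (hK : 1 ≤ K) (f : Z → Z → ℝ)
    (r : Z → S → ℝ)
    (hr_nonneg : ∀ z s, 0 ≤ r z s)
    (hr_sum : ∀ z, ∑ s, r z s = 1)
    (hr_pos : ∀ s z,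
      0 < margSZ1 (fun s z1 z2 => pS s * pC s z1 z2) s z ∨
      0 < margSZ2 (fun s z1 z2 => pS s * pC s z1 z2) s z → 0 < r z s) :
    miZ1Z2 (fun s z1 z2 => pS s * pC s z1 z2) ≥
      (∑ s, pS s *
        ∑ v : Fin K → Z × Z, (∏ k, pC s (v k).1 (v k).2) *
          ((1 / (K : ℝ)) * ∑ k : Fin K,
            (Real.log (Real.exp (f (v k).1 (v k).2) /
                ((1 / (K : ℝ)) * ∑ j : Fin K, Real.exp (f (v j).1 (v k).2)))
              + Real.log (r (v k).1 s) + Real.log (r (v k).2 s)))) +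
      (-∑ s, pS s * Real.log (pS s)) := by
  set p : S → Z → Z → ℝ := fun s z1 z2 => pS s * pC s z1 z2 with hp_def
  have hp (s z1 z2) : 0 ≤ p s z1 z2 := mul_nonneg (hpS_nonneg s) (hpC_nonneg s z1 z2)
  have hview1 := sum_mul_log_classifier_div_posterior_nonpos p hp r hr_nonneg hr_sum
    fun s z h => hr_pos s z (Or.inl h)
  have hview2 : ∑ s, ∑ z1, ∑ z2,
      p s z1 z2 * Real.log (r z2 s * margZ2 p z2 / margSZ2 p s z2) ≤ 0 := by
    have h := sum_mul_log_classifier_div_posterior_nonpos (fun s z2 z1 => p s z1 z2)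
      (fun s z2 z1 => hp s z1 z2) r hr_nonneg hr_sum fun s z h => hr_pos s z (Or.inr h)
    refine le_of_eq_of_le (Finset.sum_congr rfl fun s _ => ?_) h
    rw [Finset.sum_comm]
    rfl
  have hmi : miZ1Z2 p = ∑ s, ∑ z1, ∑ z2, p s z1 z2 *
      Real.log (margZ1Z2 p z1 z2 / (margZ1 p z1 * margZ2 p z2)) := by
    rw [miZ1Z2]
    refine Eq.trans (Finset.sum_congr rfl fun z1 _ => ?_) Finset.sum_comm
    refine Eq.trans ?_ Finset.sum_comm
    refine Finset.sum_congr rfl fun z2 _ => ?_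
    rw [← Finset.sum_mul]
    rfl
  have hsingle (s : S) : pS s * (∑ v : Fin K → Z × Z, (∏ k, pC s (v k).1 (v k).2) *
          ((1 / (K : ℝ)) * ∑ k : Fin K,
            (Real.log (Real.exp (f (v k).1 (v k).2) /
                ((1 / (K : ℝ)) * ∑ j : Fin K, Real.exp (f (v j).1 (v k).2)))
              + Real.log (r (v k).1 s) + Real.log (r (v k).2 s)))) + -(pS s * Real.log (pS s)) ≤
      ∑ z1, ∑ z2, p s z1 z2 *
        (Real.log (pC s z1 z2 / ((∑ z2', pC s z1 z2') * ∑ z1', pC s z1' z2))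
          + Real.log (r z1 s) + Real.log (r z2 s) - Real.log (pS s)) := by
    have hnce := infoNCE_le_mutualInfo (pC s) (hpC_nonneg s) (hpC_sum s) K hK f
    have hK0 : (K : ℝ) ≠ 0 := by exact_mod_cast (Nat.one_le_iff_ne_zero.1 hK)
    have hclass : ∑ v : Fin K → Z × Z, (∏ k, pC s (v k).1 (v k).2) *
        ((1 / (K : ℝ)) * ∑ k : Fin K, (Real.log (r (v k).1 s) + Real.log (r (v k).2 s))) =
        ∑ z1, ∑ z2, pC s z1 z2 * (Real.log (r z1 s) + Real.log (r z2 s)) := by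
      simp_rw [Finset.mul_sum]
      rw [Finset.sum_comm]
      have hk (k : Fin K) : ∑ v : Fin K → Z × Z, (∏ j, pC s (v j).1 (v j).2) *
          (1 / (K : ℝ) * (Real.log (r (v k).1 s) + Real.log (r (v k).2 s))) =
          1 / (K : ℝ) * ∑ z1, ∑ z2, pC s z1 z2 * (Real.log (r z1 s) + Real.log (r z2 s)) := by
        rw [sum_pi_prod_mul_eval (fun c : Z × Z => pC s c.1 c.2)
          (by rw [Fintype.sum_prod_type]; exact hpC_sum s)
          (fun c => 1 / (K : ℝ) * (Real.log (r c.1 s) + Real.log (r c.2 s))) k,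
          Fintype.sum_prod_type, Finset.mul_sum]
        refine Finset.sum_congr rfl fun z1 _ => ?_
        rw [Finset.mul_sum]
        exact Finset.sum_congr rfl fun z2 _ => by ring
      rw [Finset.sum_congr rfl fun k _ => hk k]
      simp [hK0]
    have hent : pS s * Real.log (pS s) = pS s * ∑ z1, ∑ z2, pC s z1 z2 * Real.log (pS s) := by
      simp_rw [← Finset.sum_mul]
      rw [hpC_sum, one_mul]
    rw [hent]
    have hrhs : ∑ z1, ∑ z2, p s z1 z2 *
        (Real.log (pC s z1 z2 / ((∑ z2', pC s z1 z2') * ∑ z1', pC s z1' z2))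
          + Real.log (r z1 s) + Real.log (r z2 s) - Real.log (pS s)) =
        pS s * ((∑ z1, ∑ z2, pC s z1 z2 *
          Real.log (pC s z1 z2 / ((∑ z2', pC s z1 z2') * ∑ z1', pC s z1' z2))) +
          (∑ z1, ∑ z2, pC s z1 z2 * (Real.log (r z1 s) + Real.log (r z2 s))) -
          ∑ z1, ∑ z2, pC s z1 z2 * Real.log (pS s)) := by
      simp_rw [← Finset.sum_add_distrib, ← Finset.sum_sub_distrib, Finset.mul_sum, hp_def]
      exact Finset.sum_congr rfl fun z1 _ => Finset.sum_congr rfl fun z2 _ => by ring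
    rw [hrhs, ← hclass, ← mul_neg, ← mul_add]
    refine mul_le_mul_of_nonneg_left ?_ (hpS_nonneg s)
    rw [sub_eq_add_neg]
    refine add_le_add_left (le_of_eq_of_le ?_ (add_le_add_left hnce _)) _
    rw [← Finset.sum_add_distrib]
    refine Finset.sum_congr rfl fun v _ => ?_
    rw [← mul_add, ← mul_add, ← Finset.sum_add_distrib]
    simp only [add_assoc]
  have hpoint (s : S) (z1 z2 : Z) : p s z1 z2 *
        (Real.log (pC s z1 z2 / ((∑ z2', pC s z1 z2') * ∑ z1', pC s z1' z2))
          + Real.log (r z1 s) + Real.log (r z2 s) - Real.log (pS s)) ≤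
      p s z1 z2 * Real.log (margZ1Z2 p z1 z2 / (margZ1 p z1 * margZ2 p z2)) +
      p s z1 z2 * Real.log (r z1 s * margZ1 p z1 / margSZ1 p s z1) +
      p s z1 z2 * Real.log (r z2 s * margZ2 p z2 / margSZ2 p s z2) := by
    rcases (hp s z1 z2).eq_or_lt with h | h
    · simp [← h]
    have hS : 0 < pS s := pos_of_mul_pos_left h (hpC_nonneg s z1 z2)
    have hC : 0 < pC s z1 z2 := pos_of_mul_pos_right h (hpS_nonneg s)
    have hm1 : 0 < ∑ z2', pC s z1 z2' :=
      Finset.sum_pos' (fun _ _ => hpC_nonneg _ _ _) ⟨z2, Finset.mem_univ _, hC⟩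
    have hm2 : 0 < ∑ z1', pC s z1' z2 :=
      Finset.sum_pos' (fun _ _ => hpC_nonneg _ _ _) ⟨z1, Finset.mem_univ _, hC⟩
    have hSZ1 : margSZ1 p s z1 = pS s * ∑ z2', pC s z1 z2' := by
      simp only [margSZ1, hp_def, Finset.mul_sum]
    have hSZ2 : margSZ2 p s z2 = pS s * ∑ z1', pC s z1' z2 := by
      simp only [margSZ2, hp_def, Finset.mul_sum]
    have hSZ1_pos : 0 < margSZ1 p s z1 := hSZ1 ▸ mul_pos hS hm1
    have hSZ2_pos : 0 < margSZ2 p s z2 := hSZ2 ▸ mul_pos hS hm2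
    have hr1 := hr_pos s z1 (Or.inl hSZ1_pos)
    have hr2 := hr_pos s z2 (Or.inr hSZ2_pos)
    have hZ1 : 0 < margZ1 p z1 := Finset.sum_pos'
      (fun _ _ => Finset.sum_nonneg fun _ _ => hp _ _ _) ⟨s, Finset.mem_univ _, hSZ1_pos⟩
    have hZ2 : 0 < margZ2 p z2 := Finset.sum_pos'
      (fun _ _ => Finset.sum_nonneg fun _ _ => hp _ _ _) ⟨s, Finset.mem_univ _, hSZ2_pos⟩
    have hle : p s z1 z2 ≤ margZ1Z2 p z1 z2 :=
      Finset.single_le_sum (f := fun s => p s z1 z2) (fun s _ => hp s z1 z2) (Finset.mem_univ s)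
    have hlog : Real.log (pS s) + Real.log (pC s z1 z2) ≤ Real.log (margZ1Z2 p z1 z2) := by
      rw [← Real.log_mul hS.ne' hC.ne']
      exact Real.log_le_log h hle
    rw [← mul_add, ← mul_add]
    refine mul_le_mul_of_nonneg_left ?_ h.le
    rw [hSZ1, hSZ2, Real.log_div hC.ne' (by positivity), Real.log_mul hm1.ne' hm2.ne',
      Real.log_div (h.trans_le hle).ne' (by positivity), Real.log_mul hZ1.ne' hZ2.ne',
      Real.log_div (by positivity) (by positivity), Real.log_mul hr1.ne' hZ1.ne',
      Real.log_mul hS.ne' hm1.ne', Real.log_div (by positivity) (by positivity),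
      Real.log_mul hr2.ne' hZ2.ne', Real.log_mul hS.ne' hm2.ne']
    linarith
  have htotal := Finset.sum_le_sum fun s (_ : s ∈ Finset.univ) => (hsingle s).trans
    (Finset.sum_le_sum fun z1 _ => Finset.sum_le_sum fun z2 _ => hpoint s z1 z2)
  simp only [Finset.sum_add_distrib, Finset.sum_neg_distrib] at htotal hview1 hview2 ⊢
  rw [← hmi] at htotal
  linarith

end
end

section
/- Donsker–Varadhan-type lower bound used in the proof of Proposition 1 (discrete version): Let S, Z1, Z2 be jointly distributed random variables on finite types with Z1, Z2 taking values in a finite type Z, and let f : Z × Z → ℝ. Then I(Z1; Z2 | S) ≥ ∑_{s,z1,z2} P(S=s, Z1=z1, Z2=z2) · f(z1, z2) − ∑_{s,z2} P(S=s, Z2=z2) · log( ∑_{z1} P(Z1=z1 | S=s) · exp(f(z1, z2)) ). -/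
/-!
Donsker–Varadhan-type lower bound used in the proof of Proposition 1 (discrete
version): for any `f : Z × Z → ℝ`,
I(Z1; Z2 | S) ≥ ∑_{s,z1,z2} P(S=s,Z1=z1,Z2=z2) · f(z1,z2)
             − ∑_{s,z2} P(S=s,Z2=z2) · log( ∑_{z1} P(Z1=z1|S=s) · exp(f(z1,z2)) ).
-/

open Finset

noncomputable section

variable {S Z : Type*} [Fintype S] [Fintype Z]

/-- Marginal P(S = s). -/
def margS (p : S → Z → Z → ℝ) (s : S) : ℝ := ∑ z1, ∑ z2, p s z1 z2

/-- Conditional mutual information I(Z1; Z2 | S), with terms of zero joint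
probability contributing 0. -/
def cmiZ1Z2_S (p : S → Z → Z → ℝ) : ℝ :=
  ∑ s, ∑ z1, ∑ z2, p s z1 z2 *
    Real.log ((p s z1 z2 / margS p s) /
      ((margSZ1 p s z1 / margS p s) * (margSZ2 p s z2 / margS p s)))

/-- The Donsker–Varadhan lower bound for finite nonnegative weights `a`, not necessarily normalized,
relative to nonnegative weights `q` that are positive on the support of `a`. -/
theorem sum_mul_sub_sum_mul_log_sum_exp_le {ι : Type*} [Fintype ι] (a q f : ι → ℝ)
    (ha : ∀ i, 0 ≤ a i) (hq : ∀ i, 0 ≤ q i) (haq : ∀ i, 0 < a i → 0 < q i) :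
    ∑ i, a i * f i - (∑ i, a i) * Real.log (∑ i, q i * Real.exp (f i)) ≤
      ∑ i, a i * Real.log (a i / (q i * ∑ j, a j)) := by
  set b := ∑ i, a i with hb
  set W := ∑ i, q i * Real.exp (f i) with hW
  have hb0 : 0 ≤ b := Finset.sum_nonneg fun i _ => ha i
  have hw0 : ∀ i, 0 ≤ q i * Real.exp (f i) := fun i => mul_nonneg (hq i) (Real.exp_pos _).le
  have hW0 : 0 ≤ W := Finset.sum_nonneg fun i _ => hw0 i
  have key : ∀ i, a i * f i - a i * Real.log W + a i - q i * Real.exp (f i) * (b / W) ≤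
      a i * Real.log (a i / (q i * b)) := by
    intro i
    rcases (ha i).eq_or_lt with h | h
    · simpa [← h] using mul_nonneg (hw0 i) (div_nonneg hb0 hW0)
    · have hqi := haq i h
      have hbp : 0 < b := h.trans_le (Finset.single_le_sum (fun j _ => ha j) (Finset.mem_univ i))
      have hWp : 0 < W := (mul_pos hqi (Real.exp_pos (f i))).trans_le
        (Finset.single_le_sum (fun j _ => hw0 j) (Finset.mem_univ i))
      have hx : 0 < a i / (q i * b) := by positivity
      have hlog := Real.one_sub_inv_le_log_of_pos
        (show 0 < a i / (q i * b) * W / Real.exp (f i) by positivity)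
      rw [Real.log_div (by positivity) (by positivity), Real.log_mul hx.ne' hWp.ne',
        Real.log_exp] at hlog
      have hmul := mul_le_mul_of_nonneg_left hlog h.le
      have hinv : a i * (1 - (a i / (q i * b) * W / Real.exp (f i))⁻¹) =
          a i - q i * Real.exp (f i) * (b / W) := by
        field_simp
      rw [hinv] at hmul
      linarith
  have hsum := Finset.sum_le_sum fun i (_ : i ∈ Finset.univ) => key i
  simp only [Finset.sum_sub_distrib, Finset.sum_add_distrib, ← Finset.sum_mul] at hsum
  have hWb : W * (b / W) ≤ b := by
    rcases eq_or_ne W 0 with h | h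
    · simpa [h] using hb0
    · exact (mul_div_cancel₀ b h).le
  linarith

/-- Donsker–Varadhan-type lower bound. -/
theorem donsker_varadhan_lower_bound
    (p : S → Z → Z → ℝ)
    (hp_nonneg : ∀ s z1 z2, 0 ≤ p s z1 z2)
    (hp_sum : ∑ s, ∑ z1, ∑ z2, p s z1 z2 = 1)
    (f : Z × Z → ℝ) :
    cmiZ1Z2_S p ≥
      (∑ s, ∑ z1, ∑ z2, p s z1 z2 * f (z1, z2)) -
      ∑ s, ∑ z2, margSZ2 p s z2 *
        Real.log (∑ z1, (margSZ1 p s z1 / margS p s) * Real.exp (f (z1, z2))) := by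
  rw [ge_iff_le, cmiZ1Z2_S, ← Finset.sum_sub_distrib]
  refine Finset.sum_le_sum fun s _ => ?_
  have hS1 : ∀ z1, 0 ≤ margSZ1 p s z1 := fun z1 => Finset.sum_nonneg fun z2 _ => hp_nonneg s z1 z2
  have hS : 0 ≤ margS p s := Finset.sum_nonneg fun z1 _ => hS1 z1
  have hpos : ∀ z1 z2, 0 < p s z1 z2 → 0 < margSZ1 p s z1 ∧ 0 < margS p s := by
    intro z1 z2 h
    have h1 : 0 < margSZ1 p s z1 :=
      h.trans_le (Finset.single_le_sum (fun z _ => hp_nonneg s z1 z) (Finset.mem_univ z2))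
    exact ⟨h1, h1.trans_le (Finset.single_le_sum (fun z _ => hS1 z) (Finset.mem_univ z1))⟩
  rw [Finset.sum_comm, Finset.sum_comm (f := fun z1 z2 => p s z1 z2 * Real.log _),
    ← Finset.sum_sub_distrib]
  refine Finset.sum_le_sum fun z2 _ => ?_
  refine (sum_mul_sub_sum_mul_log_sum_exp_le (fun z1 => p s z1 z2)
    (fun z1 => margSZ1 p s z1 / margS p s) (fun z1 => f (z1, z2)) (fun z1 => hp_nonneg s z1 z2)
    (fun z1 => div_nonneg (hS1 z1) hS)
    (fun z1 h => div_pos (hpos z1 z2 h).1 (hpos z1 z2 h).2)).trans_eq ?_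
  refine Finset.sum_congr rfl fun z1 _ => ?_
  rcases (hp_nonneg s z1 z2).eq_or_lt with h | h
  · simp [← h]
  · have hS' := (hpos z1 z2 h).2.ne'
    rw [← mul_div_assoc, div_div_div_cancel_right₀ hS']
    rfl

end
end
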